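/- Let 𝔾 and 𝕂 be two comonads on a category C which generate the same projective class 𝒫, and suppose that for every object X and every P ∈ 𝒫 the augmented simplicial sets Hom(P, 𝔾X) and Hom(P, 𝕂X) are Kan. Then for any functor E : C → D into any category D and any object X of C, the simplicial objects E𝔾X and E𝕂X (obtained by applying E degreewise) are homotopically equivalent: there exist semi-simplicial maps between them in both directions whose composites are simplicially homotopic to the respective identities. -/

import Mathlib

open CategoryTheory
namespace Statement9

variable {C : Type*} [Category C]

/-- Iterated application of the comonad functor: `iterObj G X n = GⁿX`. -/
def iterObj (G : Comonad C) (X : C) : ℕ → C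
  | 0 => X
  | n + 1 => G.obj (iterObj G X n)

/-- Face operators of the comonad resolution `𝔾X`:
`face G X n i : Gⁿ⁺¹X ⟶ GⁿX` is `∂ᵢ = Gⁱ ε_{Gⁿ⁻ⁱX}` (meaningful for `i ≤ n`);
`face G X 0 0 = ε_X` is the augmentation. -/
def face (G : Comonad C) (X : C) : (n i : ℕ) → (iterObj G X (n + 1) ⟶ iterObj G X n)
  | n, 0 => G.ε.app (iterObj G X n)
  | 0, _ + 1 => G.ε.app X
  | n + 1, i + 1 => G.toFunctor.map (face G X n i)

/-- A morphism `e : A ⟶ B` belongs to the class `E_𝔾` generated by the comonad `G`: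
every morphism `GY ⟶ B` factors through `e`. -/
def inE (G : Comonad C) {A B : C} (e : A ⟶ B) : Prop :=
  ∀ (Y : C) (g : G.obj Y ⟶ B), ∃ h : G.obj Y ⟶ A, h ≫ e = g

/-- `P` belongs to the projective class generated by the comonad `G`:
`P` is `E_𝔾`-projective. -/
def isProj (G : Comonad C) (P : C) : Prop :=
  ∀ {A B : C} (e : A ⟶ B), inE G e → ∀ g : P ⟶ B, ∃ h : P ⟶ A, h ≫ e = g

/-- The simplicial set `Hom(P, (obj, d))` is Kan: every `(n, k)`-horn has a filler.
Here `obj n` is the object of `n`-simplices and `d n i : obj (n+1) ⟶ obj n` the face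
operators (meaningful for `i ≤ n + 1`).  The first clause treats horns of dimension `1`,
the second those of dimension `≥ 2`. -/
def KanRaw (obj : ℕ → C) (d : (n i : ℕ) → (obj (n + 1) ⟶ obj n)) (P : C) : Prop :=
  (∀ k, k ≤ 1 → ∀ a : ℕ → (P ⟶ obj 0),
    ∃ b : P ⟶ obj 1, ∀ i, i ≤ 1 → i ≠ k → b ≫ d 0 i = a i) ∧
  (∀ (n k : ℕ), k ≤ n + 2 → ∀ a : ℕ → (P ⟶ obj (n + 1)),
    (∀ i j, i < j → j ≤ n + 2 → i ≠ k → j ≠ k →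
      a j ≫ d n i = a i ≫ d n (j - 1)) →
    ∃ b : P ⟶ obj (n + 2), ∀ i, i ≤ n + 2 → i ≠ k → b ≫ d (n + 1) i = a i)

/-- A simplicial homotopy between semi-simplicial maps `f, g : (objB, dB) ⟶ (objA, dA)`:
a family `hⁿᵢ : Bₙ ⟶ Aₙ₊₁` (for `0 ≤ i ≤ n`) with `∂₀ hⁿ₀ = fₙ`, `∂ₙ₊₁ hⁿₙ = gₙ`,
`∂ᵢ hⁿⱼ = hⁿ⁻¹ⱼ₋₁ ∂ᵢ` for `i < j`, `∂ᵢ hⁿᵢ = ∂ᵢ hⁿᵢ₋₁` for `i = j ≠ 0`, and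
`∂ᵢ hⁿⱼ = hⁿ⁻¹ⱼ ∂ᵢ₋₁` for `i > j + 1`. -/
def Homot (objB objA : ℕ → C)
    (dB : (n i : ℕ) → (objB (n + 1) ⟶ objB n))
    (dA : (n i : ℕ) → (objA (n + 1) ⟶ objA n))
    (f g : ∀ n, objB n ⟶ objA n) : Prop :=
  ∃ h : (n i : ℕ) → (objB n ⟶ objA (n + 1)),
    (∀ n, h n 0 ≫ dA n 0 = f n) ∧
    (∀ n, h n n ≫ dA n (n + 1) = g n) ∧
    (∀ n i j, i < j → j ≤ n + 1 →
      h (n + 1) j ≫ dA (n + 1) i = dB n i ≫ h n (j - 1)) ∧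
    (∀ n i, 1 ≤ i → i ≤ n →
      h n i ≫ dA n i = h n (i - 1) ≫ dA n i) ∧
    (∀ n i j, j + 1 < i → i ≤ n + 2 → j ≤ n + 1 →
      h (n + 1) j ≫ dA (n + 1) i = dB n (i - 1) ≫ h n j)

/-- Dependent choice along a sequence of relations between consecutive types. -/
theorem exists_seq_of_rel {T : ℕ → Type*} (R : ∀ n, T n → T (n + 1) → Prop)
    (a : T 0) (b : T 1) (hab : R 0 a b)
    (step : ∀ n x y, R n x y → ∃ z, R (n + 1) y z) :
    ∃ t : ∀ n, T n, t 0 = a ∧ ∀ n, R n (t n) (t (n + 1)) := by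
  choose next hnext using step
  let s : ∀ n, { p : T n × T (n + 1) // R n p.1 p.2 } := fun n =>
    Nat.rec ⟨(a, b), hab⟩ (fun n p => ⟨(p.1.2, next n _ _ p.2), hnext n _ _ p.2⟩) n
  exact ⟨fun n => (s n).1.1, rfl, fun n => (s n).2⟩

/-- The identities between face operators of an augmented semi-simplicial object, where
`A 0` is the augmentation and `A (n + 1)` the object of `n`-simplices. -/
def FaceIdentities (A : ℕ → C) (d : (n i : ℕ) → (A (n + 1) ⟶ A n)) : Prop :=
  ∀ n i j, i < j → j ≤ n + 1 → d (n + 1) j ≫ d n i = d (n + 1) i ≫ d n (j - 1)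

/-- Every sphere in the augmented simplicial set `Hom(P, (A, d))` is the boundary of a
simplex. -/
def FillsSpheres (A : ℕ → C) (d : (n i : ℕ) → (A (n + 1) ⟶ A n)) (P : C) : Prop :=
  ∀ n (a : ℕ → (P ⟶ A (n + 1))),
    (∀ i j, i < j → j ≤ n + 1 → a j ≫ d n i = a i ≫ d n (j - 1)) →
    ∃ b : P ⟶ A (n + 2), ∀ i ≤ n + 1, b ≫ d (n + 1) i = a i

section Comparison

variable {A B : ℕ → C} {dA : (n i : ℕ) → (A (n + 1) ⟶ A n)}
  {dB : (n i : ℕ) → (B (n + 1) ⟶ B n)}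

/-- A map of augmentations extends to a semi-simplicial map. -/
theorem exists_lift (hB : FaceIdentities B dB)
    (hfill : ∀ n, FillsSpheres A dA (B (n + 1)))
    (haug : ∀ a : B 1 ⟶ A 0, ∃ b : B 1 ⟶ A 1, b ≫ dA 0 0 = a) (φ : B 0 ⟶ A 0) :
    ∃ f : ∀ n, B n ⟶ A n, f 0 = φ ∧
      ∀ n i, i ≤ n → f (n + 1) ≫ dA n i = dB n i ≫ f n := by
  obtain ⟨b, hb⟩ := haug (dB 0 0 ≫ φ)
  obtain ⟨f, hf0, hf⟩ := exists_seq_of_rel (T := fun n => (B n ⟶ A n))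
    (fun n x y => ∀ i, i ≤ n → y ≫ dA n i = dB n i ≫ x) φ b
    (by intro i hi; obtain rfl : i = 0 := by omega
        exact hb)
    (by
      intro n x y hxy
      obtain ⟨z, hz⟩ := hfill (n + 1) n (fun i => dB (n + 1) i ≫ y) (by
        intro i j hij hj
        rw [Category.assoc, Category.assoc, hxy i (by omega), hxy (j - 1) (by omega),
          ← Category.assoc, ← Category.assoc, hB n i j hij hj])
      exact ⟨z, fun i hi => hz i hi⟩)
  exact ⟨f, hf0, hf⟩

/-- The maps `∂ᵢ hᵢ` occurring in a simplicial homotopy from `f` to `g`. -/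
theorem exists_intermediate (hB : FaceIdentities B dB)
    (hfill : ∀ n, FillsSpheres A dA (B (n + 1))) (f g : ∀ n, B n ⟶ A n)
    (hfg : f 0 = g 0)
    (hf : ∀ n i, i ≤ n → f (n + 1) ≫ dA n i = dB n i ≫ f n)
    (hg : ∀ n i, i ≤ n → g (n + 1) ≫ dA n i = dB n i ≫ g n) :
    ∃ r : ∀ n, ℕ → (B n ⟶ A n), ∀ n,
      r (n + 1) 0 = f (n + 1) ∧ r (n + 1) (n + 1) = g (n + 1) ∧
      (∀ i j, i ≤ n + 1 → j ≤ n → j < i → r (n + 1) i ≫ dA n j = dB n j ≫ r n (i - 1)) ∧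
      (∀ i j, i ≤ n + 1 → j ≤ n → i ≤ j → r (n + 1) i ≫ dA n j = dB n j ≫ r n i) := by
  obtain ⟨r, -, hr⟩ := exists_seq_of_rel (T := fun n => (ℕ → (B n ⟶ A n)))
    (fun n r r' => r' 0 = f (n + 1) ∧ r' (n + 1) = g (n + 1) ∧
      (∀ i j, i ≤ n + 1 → j ≤ n → j < i → r' i ≫ dA n j = dB n j ≫ r (i - 1)) ∧
      (∀ i j, i ≤ n + 1 → j ≤ n → i ≤ j → r' i ≫ dA n j = dB n j ≫ r i))
    (fun _ => f 0) (fun i => if i = 0 then f 1 else g 1)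
    (by
      refine ⟨rfl, rfl, fun i j hi hj hij => ?_, fun i j hi hj hij => ?_⟩
      · obtain rfl : i = 1 := by omega
        exact (hg 0 j hj).trans (by rw [hfg])
      · obtain rfl : i = 0 := by omega
        exact hf 0 j hj)
    (by
      rintro n r r' ⟨h0, hlast, hlt, hle⟩
      have key : ∀ i, ∃ x : B (n + 2) ⟶ A (n + 2),
          (i = 0 → x = f (n + 2)) ∧ (i = n + 2 → x = g (n + 2)) ∧
          (i ≤ n + 2 → ∀ j ≤ n + 1,
            (j < i → x ≫ dA (n + 1) j = dB (n + 1) j ≫ r' (i - 1)) ∧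
            (i ≤ j → x ≫ dA (n + 1) j = dB (n + 1) j ≫ r' i)) := by
        intro i
        by_cases hi0 : i = 0
        · subst hi0
          refine ⟨f (n + 2), fun _ => rfl, by omega, fun _ j hj => ⟨by omega, fun _ => ?_⟩⟩
          rw [hf _ _ hj, h0]
        by_cases hil : i = n + 2
        · subst hil
          refine ⟨g (n + 2), by omega, fun _ => rfl, fun _ j hj => ⟨fun _ => ?_, by omega⟩⟩
          rw [hg _ _ hj, ← hlast]; rfl
        by_cases hi : i ≤ n + 2
        · obtain ⟨x, hx⟩ := hfill (n + 1) n
            (fun j => dB (n + 1) j ≫ r' (if j < i then i - 1 else i)) (by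
              intro j k hjk hk
              have e := hB n j k hjk hk
              simp only [Category.assoc]
              rcases lt_or_ge k i with hki | hki
              · rw [if_pos hki, if_pos (by omega), hlt _ _ (by omega) (by omega) (by omega),
                  hlt _ _ (by omega) (by omega) (by omega), reassoc_of% e]
              rcases lt_or_ge j i with hji | hji
              · rw [if_neg (by omega), if_pos (by omega),
                  hlt _ _ (by omega) (by omega) (by omega),
                  hle _ _ (by omega) (by omega) (by omega), reassoc_of% e]
              · rw [if_neg (by omega), if_neg (by omega),
                  hle _ _ (by omega) (by omega) (by omega),
                  hle _ _ (by omega) (by omega) (by omega), reassoc_of% e])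
          refine ⟨x, by omega, by omega, fun _ j hj => ⟨fun h => ?_, fun h => ?_⟩⟩
          · rw [hx j hj, if_pos h]
          · rw [hx j hj, if_neg (by omega)]
        · exact ⟨f (n + 2), by omega, by omega, by omega⟩
      choose x hx0 hxl hx using key
      exact ⟨x, hx0 0 rfl, hxl _ rfl, fun i j hi hj h => (hx i hi j hj).1 h,
        fun i j hi hj h => (hx i hi j hj).2 h⟩)
  exact ⟨r, hr⟩

/-- Two semi-simplicial maps which agree on augmentations are simplicially homotopic. -/
theorem homot_of_fillsSpheres (hB : FaceIdentities B dB)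
    (hfill : ∀ n, FillsSpheres A dA (B (n + 1))) (f g : ∀ n, B n ⟶ A n)
    (hfg : f 0 = g 0)
    (hf : ∀ n i, i ≤ n → f (n + 1) ≫ dA n i = dB n i ≫ f n)
    (hg : ∀ n i, i ≤ n → g (n + 1) ≫ dA n i = dB n i ≫ g n) :
    Homot (fun n => B (n + 1)) (fun n => A (n + 1)) (fun n i => dB (n + 1) i)
      (fun n i => dA (n + 1) i) (fun n => f (n + 1)) (fun n => g (n + 1)) := by
  obtain ⟨r, hr⟩ := exists_intermediate hB hfill f g hfg hf hg
  have hlt := fun n => (hr n).2.2.1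
  have hle := fun n => (hr n).2.2.2
  obtain ⟨a, ha⟩ := hfill 0 0 (r 1) (by
    intro i j hij hj
    rw [hlt 0 j i (by omega) (by omega) (by omega), hle 0 i (j - 1) (by omega) (by omega)
      (by omega)]
    obtain rfl : i = 0 := by omega
    obtain rfl : j = 1 := by omega
    rfl)
  have step : ∀ n (p : ℕ → (B (n + 1) ⟶ A (n + 2))),
      (∀ i, i ≤ n → p i ≫ dA (n + 1) i = r (n + 1) i) →
      (∀ i, i ≤ n → p i ≫ dA (n + 1) (i + 1) = r (n + 1) (i + 1)) →
      (∀ i j k, j < k → k < i → i ≤ n + 1 →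
        dB (n + 1) k ≫ p (i - 1) ≫ dA (n + 1) j =
          dB (n + 1) j ≫ p (i - 1) ≫ dA (n + 1) (k - 1)) →
      (∀ i j k, j < i → i + 1 < k → k ≤ n + 2 →
        dB (n + 1) (k - 1) ≫ p i ≫ dA (n + 1) j =
          dB (n + 1) j ≫ p (i - 1) ≫ dA (n + 1) (k - 1)) →
      (∀ i j k, i + 1 < j → j < k → k ≤ n + 2 →
        dB (n + 1) (k - 1) ≫ p i ≫ dA (n + 1) j =
          dB (n + 1) (j - 1) ≫ p i ≫ dA (n + 1) (k - 1)) →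
      ∃ q : ℕ → (B (n + 2) ⟶ A (n + 3)),
        (∀ i, i ≤ n + 1 → q i ≫ dA (n + 2) i = r (n + 2) i) ∧
        (∀ i, i ≤ n + 1 → q i ≫ dA (n + 2) (i + 1) = r (n + 2) (i + 1)) ∧
        (∀ i j, j < i → i ≤ n + 1 → q i ≫ dA (n + 2) j = dB (n + 1) j ≫ p (i - 1)) ∧
        (∀ i j, i + 1 < j → j ≤ n + 2 → i ≤ n + 1 →
          q i ≫ dA (n + 2) j = dB (n + 1) (j - 1) ≫ p i) := by
    intro n p p0 p1 c1 c2 c3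
    have key : ∀ i, i ≤ n + 1 → ∃ x : B (n + 2) ⟶ A (n + 3), ∀ j ≤ n + 2,
        x ≫ dA (n + 2) j = if j < i then dB (n + 1) j ≫ p (i - 1) else
          if j = i then r (n + 2) i else if j = i + 1 then r (n + 2) (i + 1) else
          dB (n + 1) (j - 1) ≫ p i := by
      intro i hi
      refine hfill (n + 1) (n + 1) _ fun j k hjk hk => ?_
      rcases lt_trichotomy j i with hji | rfl | hji
      · rw [if_pos hji]
        rcases lt_trichotomy k i with hki | rfl | hki
        · rw [if_pos hki]
          simpa using c1 i j k hjk hki hi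
        · obtain ⟨m, rfl⟩ : ∃ m, k = m + 1 := ⟨k - 1, by omega⟩
          simp only [lt_irrefl, if_false, if_true, Nat.add_sub_cancel, Category.assoc]
          rw [hlt (n + 1) _ _ (by omega) (by omega) hjk, p0 m (by omega), Nat.add_sub_cancel]
        · rw [if_neg (by omega), if_neg (by omega)]
          split_ifs with hk'
          · subst hk'
            obtain ⟨m, rfl⟩ : ∃ m, i = m + 1 := ⟨i - 1, by omega⟩
            simp only [Nat.add_sub_cancel, Category.assoc]
            rw [hlt (n + 1) _ _ hk (by omega) hjk, p1 m (by omega), Nat.add_sub_cancel]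
          · simpa using c2 i j k hji (by omega) hk
      · rw [if_neg (by omega), if_neg (by omega), if_neg (lt_irrefl j), if_pos rfl]
        split_ifs with hk'
        · subst hk'
          rw [hlt (n + 1) _ _ hk (by omega) hjk, Nat.add_sub_cancel,
            hle _ _ _ (by omega) (by omega) le_rfl]
        · rw [Category.assoc, p0 j (by omega), hle _ _ _ (by omega) (by omega) (by omega)]
      · rw [if_neg (by omega), if_neg (by omega), if_neg (by omega), if_neg (by omega),
          if_neg (by omega)]
        split_ifs with hj'
        · subst hj'
          rw [Category.assoc, p1 i (by omega), hle _ _ _ (by omega) (by omega) (by omega)]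
        · simpa using c3 i j k (by omega) hjk hk
    have : Nonempty (B (n + 2) ⟶ A (n + 3)) := ⟨(key 0 (by omega)).choose⟩
    choose! q hq using key
    refine ⟨q, fun i hi => ?_, fun i hi => ?_, fun i j h hi => ?_, fun i j h hj hi => ?_⟩
    · rw [hq i hi i (by omega), if_neg (by omega), if_pos rfl]
    · rw [hq i hi _ (by omega), if_neg (by omega), if_neg (by omega), if_pos rfl]
    · rw [hq i hi j (by omega), if_pos h]
    · rw [hq i hi j (by omega), if_neg (by omega), if_neg (by omega), if_neg (by omega)]
  have a_left : ∀ i, i ≤ 0 → a ≫ dA 1 i = r 1 i := fun i hi => ha i (by omega)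
  have a_right : ∀ i, i ≤ 0 → a ≫ dA 1 (i + 1) = r 1 (i + 1) := fun i hi => ha _ (by omega)
  obtain ⟨b, hb⟩ := step 0 (fun _ => a) a_left a_right (by omega) (by omega) (by omega)
  obtain ⟨h, h0, hh⟩ := exists_seq_of_rel (T := fun n => (ℕ → (B (n + 1) ⟶ A (n + 2))))
    (fun n p q =>
      (∀ i, i ≤ n + 1 → q i ≫ dA (n + 2) i = r (n + 2) i) ∧
      (∀ i, i ≤ n + 1 → q i ≫ dA (n + 2) (i + 1) = r (n + 2) (i + 1)) ∧
      (∀ i j, j < i → i ≤ n + 1 → q i ≫ dA (n + 2) j = dB (n + 1) j ≫ p (i - 1)) ∧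
      (∀ i j, i + 1 < j → j ≤ n + 2 → i ≤ n + 1 →
        q i ≫ dA (n + 2) j = dB (n + 1) (j - 1) ≫ p i)) (fun _ => a) b hb (by
      rintro n p q ⟨q0, q1, qlt, qgt⟩
      refine step (n + 1) q q0 q1 (fun i j k hjk hki hi => ?_) (fun i j k hji hik hk => ?_)
        (fun i j k hij hjk hk => ?_)
      · rw [qlt _ _ (by omega) (by omega), qlt _ _ (by omega) (by omega),
          reassoc_of% hB (n + 1) j k hjk (by omega)]
      · rw [qlt _ _ (by omega) (by omega), qgt _ _ (by omega) (by omega) (by omega),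
          reassoc_of% hB (n + 1) j (k - 1) (by omega) (by omega)]
      · rw [qgt _ _ (by omega) (by omega) (by omega), qgt _ _ (by omega) (by omega) (by omega),
          reassoc_of% hB (n + 1) (j - 1) (k - 1) (by omega) (by omega)])
  have hr0 : ∀ n i, i ≤ n → h n i ≫ dA (n + 1) i = r (n + 1) i := by
    rintro (_ | n) i hi
    · rw [h0]; exact a_left i hi
    · exact (hh n).1 i hi
  have hr1 : ∀ n i, i ≤ n → h n i ≫ dA (n + 1) (i + 1) = r (n + 1) (i + 1) := by
    rintro (_ | n) i hi
    · rw [h0]; exact a_right i hi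
    · exact (hh n).2.1 i hi
  refine ⟨h, fun n => ?_, fun n => ?_, fun n i j hij hj => (hh n).2.2.1 j i hij hj,
    fun n i h1 hi => ?_, fun n i j hij hi hj => (hh n).2.2.2 j i hij hi hj⟩
  · exact (hr0 n 0 (by omega)).trans (hr n).1
  · exact (hr1 n n le_rfl).trans (hr n).2.1
  · obtain ⟨m, rfl⟩ : ∃ m, i = m + 1 := ⟨i - 1, by omega⟩
    exact (hr0 n _ hi).trans (hr1 n m (by omega)).symm

end Comparison

theorem Homot.map {D : Type*} [Category D] (E : C ⥤ D) {A B : ℕ → C}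
    {dA : (n i : ℕ) → (A (n + 1) ⟶ A n)} {dB : (n i : ℕ) → (B (n + 1) ⟶ B n)}
    {f g : ∀ n, B n ⟶ A n} (H : Homot B A dB dA f g) :
    Homot (fun n => E.obj (B n)) (fun n => E.obj (A n)) (fun n i => E.map (dB n i))
      (fun n i => E.map (dA n i)) (fun n => E.map (f n)) (fun n => E.map (g n)) := by
  obtain ⟨h, h0, hl, hlt, heq, hgt⟩ := H
  refine ⟨fun n i => E.map (h n i), fun n => ?_, fun n => ?_, fun n i j hij hj => ?_,
    fun n i h1 hi => ?_, fun n i j hij hi hj => ?_⟩ <;> simp only [← E.map_comp]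
  · rw [h0]
  · rw [hl]
  · rw [hlt n i j hij hj]
  · rw [heq n i h1 hi]
  · rw [hgt n i j hij hi hj]

section Comonad

variable (G : Comonad C)

theorem faceIdentities (X : C) : FaceIdentities (iterObj G X) (face G X) := by
  intro n
  induction n with
  | zero =>
    intro i j hij hj
    obtain rfl : i = 0 := by omega
    obtain rfl : j = 1 := by omega
    exact G.ε.naturality (G.ε.app X)
  | succ n ih =>
    rintro i (_ | j) hij hj
    · omega
    rcases i with _ | i
    · exact G.ε.naturality (face G X (n + 1) j)
    · obtain ⟨m, rfl⟩ : ∃ m, j = m + 1 := ⟨j - 1, by omega⟩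
      have := congrArg G.toFunctor.map (ih i (m + 1) (by omega) (by omega))
      rw [Functor.map_comp, Functor.map_comp] at this
      exact this

theorem isProj_obj (Y : C) : isProj G (G.obj Y) := fun _ he g => he Y g

variable {G}

theorem isProj_of_inE_iff {K : Comonad C}
    (h : ∀ {A B : C} (e : A ⟶ B), inE G e ↔ inE K e) {P : C} (hP : isProj K P) :
    isProj G P := fun e he g => hP e ((h e).1 he) g

/-- A projective object is a retract of its image under the comonad. -/
theorem isProj.exists_section {P : C} (hP : isProj G P) :
    ∃ t : P ⟶ G.obj P, t ≫ G.ε.app P = 𝟙 P :=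
  hP (G.ε.app P) (fun Y g => ⟨G.δ.app Y ≫ G.map g, by simp⟩) (𝟙 P)

theorem isProj.exists_comp_face_eq {P : C} (hP : isProj G P) (X : C)
    (a : P ⟶ iterObj G X 0) : ∃ b : P ⟶ iterObj G X 1, b ≫ face G X 0 0 = a := by
  obtain ⟨t, ht⟩ := hP.exists_section
  refine ⟨t ≫ G.map a, ?_⟩
  change (t ≫ G.map a) ≫ G.ε.app X = a
  have := G.ε.naturality a
  dsimp at this
  erw [Category.assoc, this, reassoc_of% ht]

/-- A Kan simplicial set `Hom(P, 𝔾X)` with `P` projective fills spheres: the section of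
`ε_P` provides an extra degeneracy, which turns a sphere into a horn. -/
theorem isProj.fillsSpheres {P : C} (hP : isProj G P) (X : C)
    (hkan : KanRaw (fun n => iterObj G X (n + 1)) (fun n i => face G X (n + 1) i) P) :
    FillsSpheres (iterObj G X) (face G X) P := by
  intro n a ha
  obtain ⟨t, ht⟩ := hP.exists_section
  let s : ∀ {m}, (P ⟶ iterObj G X m) → (P ⟶ iterObj G X (m + 1)) := fun x => t ≫ G.map x
  have s_zero : ∀ {m} (x : P ⟶ iterObj G X m), s x ≫ face G X m 0 = x := by
    intro m x
    have hf : face G X m 0 = G.ε.app (iterObj G X m) := by cases m <;> rfl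
    have := G.ε.naturality x
    dsimp at this
    rw [hf]
    erw [Category.assoc, this, reassoc_of% ht]
  have s_succ : ∀ {m} (x : P ⟶ iterObj G X (m + 1)) i,
      s x ≫ face G X (m + 1) (i + 1) = s (x ≫ face G X m i) := by
    intro m x i
    change (t ≫ G.map x) ≫ G.map (face G X m i) = t ≫ G.map (x ≫ face G X m i)
    rw [Category.assoc, Functor.map_comp]
  obtain ⟨b, hb⟩ := hkan.2 n 0 (by omega) (fun i => s (a (i - 1))) (by
    intro i j hij hj hi _
    obtain ⟨i, rfl⟩ : ∃ m, i = m + 1 := ⟨i - 1, by omega⟩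
    obtain ⟨j, rfl⟩ : ∃ m, j = m + 2 := ⟨j - 2, by omega⟩
    change s (a (j + 1)) ≫ face G X (n + 1) (i + 1) = s (a i) ≫ face G X (n + 1) (j + 1)
    rw [s_succ, s_succ, ha i (j + 1) (by omega) (by omega), Nat.add_sub_cancel])
  refine ⟨b ≫ face G X (n + 2) 0, fun i hi => ?_⟩
  have e := faceIdentities G X (n + 1) 0 (i + 1) (by omega) (by omega)
  have hb' : b ≫ face G X (n + 2) (i + 1) = s (a i) := hb (i + 1) (by omega) (by omega)
  rw [Nat.add_sub_cancel] at e
  rw [Category.assoc, ← e, ← Category.assoc, hb', s_zero]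

end Comonad

/-- Let `G` and `K` be two comonads on `C` generating the same
projective class (hypothesis `hsame`), such that for every object `X` and every `P` in
the class the simplicial sets `Hom(P, 𝔾X)` and `Hom(P, 𝕂X)` are Kan.  Then for any
functor `E : C ⥤ D` and any object `X`, the simplicial objects `E𝔾X` and `E𝕂X`
(obtained by applying `E` degreewise) are homotopically equivalent: there are
semi-simplicial maps in both directions whose composites are simplicially homotopic to
the respective identities. -/
theorem statement9 {D : Type*} [Category D] (G K : Comonad C)
    (hsame : ∀ {A B : C} (e : A ⟶ B), inE G e ↔ inE K e)
    (hkan : ∀ (X P : C), isProj G P →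
      KanRaw (fun n => iterObj G X (n + 1)) (fun n i => face G X (n + 1) i) P ∧
      KanRaw (fun n => iterObj K X (n + 1)) (fun n i => face K X (n + 1) i) P)
    (E : C ⥤ D) (X : C) :
    ∃ (f : ∀ n, E.obj (iterObj G X (n + 1)) ⟶ E.obj (iterObj K X (n + 1)))
      (g : ∀ n, E.obj (iterObj K X (n + 1)) ⟶ E.obj (iterObj G X (n + 1))),
      (∀ n i, i ≤ n + 1 →
        f (n + 1) ≫ E.map (face K X (n + 1) i) = E.map (face G X (n + 1) i) ≫ f n) ∧
      (∀ n i, i ≤ n + 1 →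
        g (n + 1) ≫ E.map (face G X (n + 1) i) = E.map (face K X (n + 1) i) ≫ g n) ∧
      Homot (fun n => E.obj (iterObj G X (n + 1))) (fun n => E.obj (iterObj G X (n + 1)))
        (fun n i => E.map (face G X (n + 1) i)) (fun n i => E.map (face G X (n + 1) i))
        (fun n => f n ≫ g n) (fun n => 𝟙 (E.obj (iterObj G X (n + 1)))) ∧
      Homot (fun n => E.obj (iterObj K X (n + 1))) (fun n => E.obj (iterObj K X (n + 1)))
        (fun n i => E.map (face K X (n + 1) i)) (fun n i => E.map (face K X (n + 1) i))
        (fun n => g n ≫ f n) (fun n => 𝟙 (E.obj (iterObj K X (n + 1)))) := by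
  have projG : ∀ n, isProj G (iterObj G X (n + 1)) := fun n => isProj_obj G _
  have projK : ∀ n, isProj K (iterObj K X (n + 1)) := fun n => isProj_obj K _
  have projGK : ∀ n, isProj G (iterObj K X (n + 1)) := fun n =>
    isProj_of_inE_iff hsame (projK n)
  have projKG : ∀ n, isProj K (iterObj G X (n + 1)) := fun n =>
    isProj_of_inE_iff (fun e => (hsame e).symm) (projG n)
  obtain ⟨f, hf0, hf⟩ := exists_lift (faceIdentities G X)
    (fun n => isProj.fillsSpheres (projKG n) X (hkan X _ (projG n)).2)
    (isProj.exists_comp_face_eq (projKG 0) X) (𝟙 X)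
  obtain ⟨g, hg0, hg⟩ := exists_lift (faceIdentities K X)
    (fun n => isProj.fillsSpheres (projGK n) X (hkan X _ (projGK n)).1)
    (isProj.exists_comp_face_eq (projGK 0) X) (𝟙 X)
  have Hfg := homot_of_fillsSpheres (faceIdentities G X)
    (fun n => isProj.fillsSpheres (projG n) X (hkan X _ (projG n)).1)
    (fun n => f n ≫ g n) (fun n => 𝟙 _) (by
      rw [hf0, hg0]; exact Category.id_comp _)
    (fun n i hi => by rw [Category.assoc, hg n i hi, reassoc_of% hf n i hi])
    (fun n i hi => by rw [Category.id_comp, Category.comp_id])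
  have Hgf := homot_of_fillsSpheres (faceIdentities K X)
    (fun n => isProj.fillsSpheres (projK n) X (hkan X _ (projGK n)).2)
    (fun n => g n ≫ f n) (fun n => 𝟙 _) (by
      rw [hf0, hg0]; exact Category.id_comp _)
    (fun n i hi => by rw [Category.assoc, hf n i hi, reassoc_of% hg n i hi])
    (fun n i hi => by rw [Category.id_comp, Category.comp_id])
  refine ⟨fun n => E.map (f (n + 1)), fun n => E.map (g (n + 1)), fun n i hi => ?_,
    fun n i hi => ?_, ?_, ?_⟩
  · rw [← E.map_comp, ← E.map_comp, hf (n + 1) i hi]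
  · rw [← E.map_comp, ← E.map_comp, hg (n + 1) i hi]
  · simpa only [E.map_comp, E.map_id] using Hfg.map E
  · simpa only [E.map_comp, E.map_id] using Hgf.map E

end Statement9
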